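/- arXiv:0907.1548 — 2 statements merged into one kernel-verified Lean document; each statement's English description precedes it below -/
import Mathlib

section
/- (Malcev-admissibility) Let A be an alternative algebra over a field K of characteristic 0, and define the commutator bracket [x,y] = xy − yx and the Jacobian J(x,y,z) = [x,[y,z]] + [y,[z,x]] + [z,[x,y]]. Then the bracket is skew-symmetric and satisfies the Malcev identity [J(x,y,z), x] = J(x, y, [x,z]) for all x, y, z ∈ A; that is, (A, [·,·]) is a Malcev algebra. -/
/-- The commutator bracket of a bilinear multiplication. -/
def commBracket {K A : Type*} [Field K] [AddCommGroup A] [Module K A]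
    (μ : A →ₗ[K] A →ₗ[K] A) (x y : A) : A :=
  μ x y - μ y x

/-- The Jacobian of the commutator bracket. -/
def jacobian {K A : Type*} [Field K] [AddCommGroup A] [Module K A]
    (μ : A →ₗ[K] A →ₗ[K] A) (x y z : A) : A :=
  commBracket μ x (commBracket μ y z) + commBracket μ y (commBracket μ z x) +
    commBracket μ z (commBracket μ x y)


/-- The associator of a bilinear multiplication. -/
def asr {K A : Type*} [Field K] [AddCommGroup A] [Module K A]
    (μ : A →ₗ[K] A →ₗ[K] A) (x y z : A) : A :=
  μ (μ x y) z - μ x (μ y z)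

theorem asr_teich {K A : Type*} [Field K] [AddCommGroup A] [Module K A]
    (μ : A →ₗ[K] A →ₗ[K] A) (w x y z : A) :
    asr μ (μ w x) y z - asr μ w (μ x y) z + asr μ w x (μ y z) =
      μ w (asr μ x y z) + μ (asr μ w x y) z := by
  simp only [asr, map_sub, LinearMap.sub_apply]
  abel

theorem jacobian_eq {K A : Type*} [Field K] [AddCommGroup A] [Module K A]
    (μ : A →ₗ[K] A →ₗ[K] A) (x y z : A)
    (h12 : ∀ x y z, asr μ x y z = - asr μ y x z)
    (h23 : ∀ x y z, asr μ x y z = - asr μ x z y) :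
    jacobian μ x y z = (-6 : K) • asr μ x y z := by
  have e : jacobian μ x y z = - asr μ x y z - asr μ y z x - asr μ z x y
      + asr μ x z y + asr μ z y x + asr μ y x z := by
    simp only [jacobian, commBracket, asr, map_sub, LinearMap.sub_apply]
    abel
  rw [e, h23 y z x, h12 z x y, h23 z y x, h12 z x y, h23 x z y, h12 y x z]
  module

/-- Alternative algebras are Malcev-admissible: the commutator bracket is
skew-symmetric and satisfies the Malcev identity. -/
theorem alternative_malcevAdmissible
    {K A : Type*} [Field K] [CharZero K] [AddCommGroup A] [Module K A]
    (μ : A →ₗ[K] A →ₗ[K] A)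
    (hleft : ∀ x y : A, μ x (μ x y) = μ (μ x x) y)
    (hright : ∀ x y : A, μ (μ x y) y = μ x (μ y y)) :
    (∀ x y : A, commBracket μ x y = - commBracket μ y x) ∧
    (∀ x y z : A,
      commBracket μ (jacobian μ x y z) x = jacobian μ x y (commBracket μ x z)) := by
  have h12 : ∀ x y z, asr μ x y z = - asr μ y x z := by
    intro x y z
    have h := hleft (x + y) z
    simp only [map_add, LinearMap.add_apply, hleft x z, hleft y z] at h
    simp only [asr]
    linear_combination (norm := module) -h
  have h23 : ∀ x y z, asr μ x y z = - asr μ x z y := by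
    intro x y z
    have h := hright x (y + z)
    simp only [map_add, LinearMap.add_apply, hright x z, hright x y] at h
    simp only [asr]
    linear_combination (norm := module) h
  have hl : ∀ x y, asr μ x x y = 0 := fun x y => by simp [asr, hleft]
  have hr : ∀ x y, asr μ x y y = 0 := fun x y => by simp [asr, hright]
  refine ⟨fun x y => by simp [commBracket], fun x y z => ?_⟩
  rw [jacobian_eq μ x y z h12 h23, jacobian_eq μ x y _ h12 h23]
  have t1 := asr_teich μ x x z y
  have t2 := asr_teich μ y z x x
  rw [hl, h23 x z y, h12 x (μ x z) y, h23 (μ x x) z y] at t1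
  rw [hr, hr, h23 y (μ z x) x, h12 y x (μ z x), h23 y z (μ x x), h12 y (μ x x) z,
    h23 y z x, h12 y x z] at t2
  have e : asr μ x y (commBracket μ x z) = asr μ x y (μ x z) - asr μ x y (μ z x) := by
    simp only [commBracket, asr, map_sub]
    abel
  have e1 : asr μ (μ x z) x y = asr μ x y (μ x z) := by
    rw [h12, h23, neg_neg]
  rw [e1] at t1
  rw [e]
  simp only [commBracket, map_smul, LinearMap.smul_apply, map_neg, map_zero,
    LinearMap.neg_apply, LinearMap.zero_apply, neg_neg, hl] at t1 t2 ⊢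
  linear_combination (norm := module) (6 : K) • t1 + (6 : K) • t2
end

section
/- (Rigidity when H² vanishes) Let (A, μ₀) be a left alternative algebra over a field K of characteristic 0 and suppose every 2-cocycle is a 2-coboundary, i.e. for every bilinear map φ with δ²φ = 0 there is a linear map f: A → A with φ = δ¹f (in other words H²(A,A) = 0). Then every formal left alternative deformation (μ_i)_{i≥0} of (A, μ₀) is equivalent to the trivial deformation: there exists a sequence of linear maps Φ_i: A → A (i ≥ 0) with Φ₀ = id such that for every k ≥ 0 and all x, y ∈ A, Σ_{i+j=k} Φ_i(μ_j(x,y)) = Σ_{i+j=k} μ₀(Φ_i(x), Φ_j(y)). -/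
/-- The order-`k` deformation equation for a sequence of bilinear maps. -/
def DeformEq {K A : Type*} [Field K] [AddCommGroup A] [Module K A]
    (μ : ℕ → (A →ₗ[K] A →ₗ[K] A)) (k : ℕ) : Prop :=
  ∀ x y z : A,
    ∑ i ∈ Finset.range (k + 1),
      (μ i x (μ (k - i) y z) - μ i (μ (k - i) x y) z +
        μ i y (μ (k - i) x z) - μ i (μ (k - i) y x) z) = 0

/-- The first differential of a linear map. -/
def d1 {K A : Type*} [Field K] [AddCommGroup A] [Module K A]
    (μ : A →ₗ[K] A →ₗ[K] A) (f : A →ₗ[K] A) : A → A → A :=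
  fun x y => μ (f x) y + μ x (f y) - f (μ x y)

/-- The second differential of a bilinear map (given as a function). -/
def d2 {K A : Type*} [Field K] [AddCommGroup A] [Module K A]
    (μ : A →ₗ[K] A →ₗ[K] A) (φ : A → A → A) : A → A → A → A :=
  fun x y z =>
    μ (φ x y) z - μ x (φ y z) + φ (μ x y) z - φ x (μ y z) +
    μ (φ y x) z - μ y (φ x z) + φ (μ y x) z - φ y (μ x z)

open Finset in
/-- Reassociation of a triple convolution sum. -/
lemma triple_reassoc {M : Type*} [AddCommMonoid M] (n : ℕ) (F : ℕ → ℕ → ℕ → M) :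
    ∑ p ∈ antidiagonal n, ∑ q ∈ antidiagonal p.2, F p.1 q.1 q.2 =
      ∑ p ∈ antidiagonal n, ∑ q ∈ antidiagonal p.1, F q.1 q.2 p.2 := by
  rw [Finset.sum_sigma', Finset.sum_sigma']
  refine Finset.sum_bij' (fun a _ => ⟨(a.1.1 + a.2.1, a.2.2), (a.1.1, a.2.1)⟩)
    (fun a _ => ⟨(a.2.1, a.2.2 + a.1.2), (a.2.2, a.1.2)⟩) ?_ ?_ ?_ ?_ ?_
  all_goals
    rintro ⟨⟨a, b⟩, ⟨c, d⟩⟩ h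
    simp only [Finset.mem_sigma, HasAntidiagonal.mem_antidiagonal] at h ⊢
  · exact ⟨by omega, trivial⟩
  · exact ⟨by omega, trivial⟩
  · obtain ⟨h1, rfl⟩ := h
    rfl
  · obtain ⟨h1, rfl⟩ := h
    rfl

open Finset in
/-- Swapping the first two indices of a triple convolution sum. -/
lemma triple_swap {M : Type*} [AddCommMonoid M] (n : ℕ) (F : ℕ → ℕ → ℕ → M) :
    ∑ p ∈ antidiagonal n, ∑ q ∈ antidiagonal p.1, F q.1 q.2 p.2 =
      ∑ p ∈ antidiagonal n, ∑ q ∈ antidiagonal p.1, F q.2 q.1 p.2 := by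
  refine Finset.sum_congr rfl fun p _ => ?_
  exact (Finset.Nat.sum_antidiagonal_swap (n := p.1) (f := fun q => F q.1 q.2 p.2)).symm

open Finset in
/-- The defect of `Φ` from being a morphism from `μ` to the trivial deformation. -/
def defect {K A : Type*} [Field K] [AddCommGroup A] [Module K A]
    (μ : ℕ → (A →ₗ[K] A →ₗ[K] A)) (Φ : ℕ → (A →ₗ[K] A)) (k : ℕ) : A →ₗ[K] A →ₗ[K] A :=
  ∑ p ∈ antidiagonal k, ((μ p.2).compr₂ (Φ p.1) - (μ 0).compl₁₂ (Φ p.1) (Φ p.2))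

section
open Finset
variable {K A : Type*} [Field K] [AddCommGroup A] [Module K A]
  (μ : ℕ → (A →ₗ[K] A →ₗ[K] A)) (Φ : ℕ → (A →ₗ[K] A))

lemma defect_apply (k : ℕ) (x y : A) :
    defect μ Φ k x y = ∑ p ∈ antidiagonal k, Φ p.1 (μ p.2 x y)
      - ∑ p ∈ antidiagonal k, μ 0 (Φ p.1 x) (Φ p.2 y) := by
  simp [defect, LinearMap.sum_apply, Finset.sum_sub_distrib]

lemma phi_mu (k : ℕ) (x y : A) :
    ∑ p ∈ antidiagonal k, Φ p.1 (μ p.2 x y) =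
      ∑ p ∈ antidiagonal k, μ 0 (Φ p.1 x) (Φ p.2 y) + defect μ Φ k x y := by
  rw [defect_apply]; abel

lemma sum_last {M : Type*} [AddCommMonoid M] (n : ℕ) (G : ℕ → ℕ → M)
    (h : ∀ a b, a < n → G a b = 0) : ∑ p ∈ antidiagonal n, G p.1 p.2 = G n 0 := by
  rw [Finset.sum_eq_single (n, 0)]
  · rintro ⟨a, b⟩ hp hne
    rw [HasAntidiagonal.mem_antidiagonal] at hp
    simp only at hp
    apply h
    by_contra hc
    exact hne (by ext <;> simp <;> omega)
  · simp

lemma sum_first {M : Type*} [AddCommMonoid M] (n : ℕ) (G : ℕ → ℕ → M)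
    (h : ∀ a b, b < n → G a b = 0) : ∑ p ∈ antidiagonal n, G p.1 p.2 = G 0 n := by
  rw [← Finset.Nat.sum_antidiagonal_swap]
  exact sum_last n (fun a b => G b a) fun a b hab => h b a hab

lemma left_expand (n : ℕ) (h0 : Φ 0 = LinearMap.id) (hD : ∀ k < n, defect μ Φ k = 0) (x y z : A) :
    ∑ p ∈ antidiagonal n, ∑ q ∈ antidiagonal p.2, Φ p.1 (μ q.1 x (μ q.2 y z)) =
      ∑ p ∈ antidiagonal n, ∑ q ∈ antidiagonal p.1, μ 0 (Φ q.1 x) (μ 0 (Φ q.2 y) (Φ p.2 z))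
        + μ 0 x (defect μ Φ n y z) + defect μ Φ n x (μ 0 y z) := by
  rw [triple_reassoc n (fun a b c => Φ a (μ b x (μ c y z)))]
  simp only [phi_mu μ Φ, Finset.sum_add_distrib]
  rw [sum_last n (fun a b => defect μ Φ a x (μ b y z)) (fun a b h => by simp [hD a h]),
    ← triple_reassoc n (fun a b c => μ 0 (Φ a x) (Φ b (μ c y z)))]
  simp only [← map_sum, phi_mu μ Φ, map_add, Finset.sum_add_distrib]
  rw [sum_first n (fun a b => μ 0 (Φ a x) (defect μ Φ b y z)) (fun a b h => by simp [hD b h]), h0]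
  simp only [map_sum, LinearMap.id_apply]
  rw [triple_reassoc n (fun a b c => μ 0 (Φ a x) (μ 0 (Φ b y) (Φ c z)))]

lemma right_expand (n : ℕ) (h0 : Φ 0 = LinearMap.id) (hD : ∀ k < n, defect μ Φ k = 0) (x y z : A) :
    ∑ p ∈ antidiagonal n, ∑ q ∈ antidiagonal p.2, Φ p.1 (μ q.1 (μ q.2 x y) z) =
      ∑ p ∈ antidiagonal n, ∑ q ∈ antidiagonal p.1, μ 0 (μ 0 (Φ q.1 x) (Φ q.2 y)) (Φ p.2 z)
        + μ 0 (defect μ Φ n x y) z + defect μ Φ n (μ 0 x y) z := by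
  rw [triple_reassoc n (fun a b c => Φ a (μ b (μ c x y) z))]
  simp only [phi_mu μ Φ, Finset.sum_add_distrib]
  rw [sum_last n (fun a b => defect μ Φ a (μ b x y) z) (fun a b h => by simp [hD a h])]
  -- move the index of `μ` next to the index of the inner `Φ`
  have key : ∑ p ∈ antidiagonal n, ∑ q ∈ antidiagonal p.1, μ 0 (Φ q.1 (μ p.2 x y)) (Φ q.2 z) =
      ∑ p ∈ antidiagonal n, ∑ q ∈ antidiagonal p.1, μ 0 (Φ q.1 (μ q.2 x y)) (Φ p.2 z) := by
    rw [← triple_reassoc n (fun a b c => μ 0 (Φ a (μ c x y)) (Φ b z)),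
      ← triple_reassoc n (fun a b c => μ 0 (Φ a (μ b x y)) (Φ c z))]
    refine Finset.sum_congr rfl fun p _ => ?_
    exact (Finset.Nat.sum_antidiagonal_swap (n := p.2)
      (f := fun q => μ 0 (Φ p.1 (μ q.1 x y)) (Φ q.2 z)))
  rw [key]
  have inner : ∀ p : ℕ × ℕ, ∑ q ∈ antidiagonal p.1, μ 0 (Φ q.1 (μ q.2 x y)) (Φ p.2 z) =
      ∑ q ∈ antidiagonal p.1, μ 0 (μ 0 (Φ q.1 x) (Φ q.2 y)) (Φ p.2 z)
        + μ 0 (defect μ Φ p.1 x y) (Φ p.2 z) := by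
    intro p
    have := congrArg (fun w => μ 0 w (Φ p.2 z)) (phi_mu μ Φ p.1 x y)
    simpa only [map_sum, map_add, LinearMap.add_apply, LinearMap.sum_apply] using this
  simp only [inner, Finset.sum_add_distrib]
  rw [sum_last n (fun a b => μ 0 (defect μ Φ a x y) (Φ b z)) (fun a b h => by simp [hD a h]), h0]
  simp only [LinearMap.id_apply]

lemma defect_cocycle (hdef : ∀ k : ℕ, DeformEq μ k)
    (n : ℕ) (h0 : Φ 0 = LinearMap.id) (hD : ∀ k < n, defect μ Φ k = 0) (x y z : A) :
    d2 (μ 0) (fun a b => defect μ Φ n a b) x y z = 0 := by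
  have lin : ∀ x y z, μ 0 x (μ 0 y z) - μ 0 (μ 0 x y) z
      + μ 0 y (μ 0 x z) - μ 0 (μ 0 y x) z = 0 := by
    intro x y z
    simpa [DeformEq] using hdef 0 x y z
  have hd : ∀ k, ∑ q ∈ antidiagonal k, (μ q.1 x (μ q.2 y z) - μ q.1 (μ q.2 x y) z
      + μ q.1 y (μ q.2 x z) - μ q.1 (μ q.2 y x) z) = 0 := by
    intro k
    rw [Finset.Nat.sum_antidiagonal_eq_sum_range_succ (fun a b => μ a x (μ b y z) - μ a (μ b x y) z
      + μ a y (μ b x z) - μ a (μ b y x) z)]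
    exact hdef k x y z
  have H : ∑ p ∈ antidiagonal n, Φ p.1 (∑ q ∈ antidiagonal p.2,
      (μ q.1 x (μ q.2 y z) - μ q.1 (μ q.2 x y) z
      + μ q.1 y (μ q.2 x z) - μ q.1 (μ q.2 y x) z)) = 0 := by
    simp [hd]
  simp only [map_sum, map_sub, map_add, Finset.sum_add_distrib, Finset.sum_sub_distrib] at H
  rw [left_expand μ Φ n h0 hD, left_expand μ Φ n h0 hD, right_expand μ Φ n h0 hD,
    right_expand μ Φ n h0 hD] at H
  have T : ∑ p ∈ antidiagonal n, ∑ q ∈ antidiagonal p.1,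
      (μ 0 (Φ q.1 x) (μ 0 (Φ q.2 y) (Φ p.2 z)) - μ 0 (μ 0 (Φ q.1 x) (Φ q.2 y)) (Φ p.2 z)
      + μ 0 (Φ q.2 y) (μ 0 (Φ q.1 x) (Φ p.2 z)) - μ 0 (μ 0 (Φ q.2 y) (Φ q.1 x)) (Φ p.2 z)) = 0 := by
    simp [lin]
  simp only [Finset.sum_add_distrib, Finset.sum_sub_distrib] at T
  rw [triple_swap n (fun a b c => μ 0 (Φ b y) (μ 0 (Φ a x) (Φ c z))),
    triple_swap n (fun a b c => μ 0 (μ 0 (Φ b y) (Φ a x)) (Φ c z))] at T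
  simp only [d2]
  linear_combination (norm := abel) T - H

lemma defect_congr (Ψ : ℕ → (A →ₗ[K] A)) (k : ℕ) (h : ∀ i ≤ k, Φ i = Ψ i) :
    defect μ Φ k = defect μ Ψ k := by
  refine Finset.sum_congr rfl fun p hp => ?_
  rw [HasAntidiagonal.mem_antidiagonal] at hp
  rw [h p.1 (by omega), h p.2 (by omega)]

lemma defect_add_single (n : ℕ) (hn : 0 < n) (h0 : Φ 0 = LinearMap.id) (f : A →ₗ[K] A) (x y : A) :
    defect μ (Φ + Pi.single n f) n x y = defect μ Φ n x y - d1 (μ 0) f x y := by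
  have e1 : ∑ p ∈ antidiagonal n, (Pi.single n f : ℕ → (A →ₗ[K] A)) p.1 (μ p.2 x y)
      = f (μ 0 x y) := by
    rw [sum_last n (fun a b => (Pi.single n f : ℕ → (A →ₗ[K] A)) a (μ b x y))
      (fun a b h => by simp [Pi.single_eq_of_ne h.ne])]
    simp
  have e2 : ∑ p ∈ antidiagonal n, μ 0 ((Pi.single n f : ℕ → (A →ₗ[K] A)) p.1 x) (Φ p.2 y)
      = μ 0 (f x) y := by
    rw [sum_last n (fun a b => μ 0 ((Pi.single n f : ℕ → (A →ₗ[K] A)) a x) (Φ b y))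
      (fun a b h => by simp [Pi.single_eq_of_ne h.ne])]
    simp [h0]
  have e3 : ∑ p ∈ antidiagonal n, μ 0 (Φ p.1 x) ((Pi.single n f : ℕ → (A →ₗ[K] A)) p.2 y)
      = μ 0 x (f y) := by
    rw [sum_first n (fun a b => μ 0 (Φ a x) ((Pi.single n f : ℕ → (A →ₗ[K] A)) b y))
      (fun a b h => by simp [Pi.single_eq_of_ne h.ne])]
    simp [h0]
  have e4 : ∑ p ∈ antidiagonal n, μ 0 ((Pi.single n f : ℕ → (A →ₗ[K] A)) p.1 x)
      ((Pi.single n f : ℕ → (A →ₗ[K] A)) p.2 y) = 0 := by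
    rw [sum_last n (fun a b => μ 0 ((Pi.single n f : ℕ → (A →ₗ[K] A)) a x)
      ((Pi.single n f : ℕ → (A →ₗ[K] A)) b y))
      (fun a b h => by simp [Pi.single_eq_of_ne h.ne])]
    simp [Pi.single_eq_of_ne hn.ne]
  simp only [defect_apply, Pi.add_apply, LinearMap.add_apply, map_add, Finset.sum_add_distrib,
    e1, e2, e3, e4, d1]
  abel

lemma step (hH2 : ∀ φ : A →ₗ[K] A →ₗ[K] A,
      (∀ x y z : A, d2 (μ 0) (fun a b => φ a b) x y z = 0) →
      ∃ f : A →ₗ[K] A, ∀ x y : A, φ x y = d1 (μ 0) f x y)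
    (hdef : ∀ k : ℕ, DeformEq μ k) (n : ℕ) (h0 : Φ 0 = LinearMap.id)
    (hD : ∀ k < n + 1, defect μ Φ k = 0) :
    ∃ Ψ : ℕ → (A →ₗ[K] A), (Ψ 0 = LinearMap.id ∧ ∀ k < n + 2, defect μ Ψ k = 0) ∧
      ∀ i ≤ n, Ψ i = Φ i := by
  obtain ⟨f, hf⟩ := hH2 (defect μ Φ (n + 1)) (defect_cocycle μ Φ hdef (n + 1) h0 hD)
  have agree : ∀ i ≤ n, (Φ + Pi.single (n + 1) f : ℕ → (A →ₗ[K] A)) i = Φ i := by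
    intro i hi
    have : i ≠ n + 1 := by omega
    simp [Pi.single_eq_of_ne this]
  refine ⟨Φ + Pi.single (n + 1) f, ⟨by rw [agree 0 (by omega), h0], fun k hk => ?_⟩, agree⟩
  rcases Nat.lt_succ_iff_lt_or_eq.mp hk with h | rfl
  · rw [defect_congr μ _ Φ k (fun i hi => agree i (by omega)), hD k h]
  · ext x y
    rw [defect_add_single μ Φ (n + 1) (by omega) h0, hf]
    simp

end

/-- If `H²(A,A) = 0` then every formal left alternative deformation is
equivalent to the trivial deformation. -/
theorem h2_zero_implies_rigid
    {K A : Type*} [Field K] [CharZero K] [AddCommGroup A] [Module K A]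
    (μ : ℕ → (A →ₗ[K] A →ₗ[K] A))
    (hleft : ∀ x y : A, μ 0 x (μ 0 x y) = μ 0 (μ 0 x x) y)
    (hH2 : ∀ φ : A →ₗ[K] A →ₗ[K] A,
      (∀ x y z : A, d2 (μ 0) (fun a b => φ a b) x y z = 0) →
      ∃ f : A →ₗ[K] A, ∀ x y : A, φ x y = d1 (μ 0) f x y)
    (hdef : ∀ k : ℕ, DeformEq μ k) :
    ∃ Φ : ℕ → (A →ₗ[K] A),
      Φ 0 = LinearMap.id ∧
      ∀ k : ℕ, ∀ x y : A,
        ∑ i ∈ Finset.range (k + 1), Φ i (μ (k - i) x y) =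
          ∑ i ∈ Finset.range (k + 1), μ 0 (Φ i x) (Φ (k - i) y) := by
  classical
  let S (n : ℕ) := {Φ : ℕ → (A →ₗ[K] A) // Φ 0 = LinearMap.id ∧ ∀ k < n + 1, defect μ Φ k = 0}
  have base : S 0 := ⟨fun _ => LinearMap.id, rfl, by
    intro k hk
    obtain rfl : k = 0 := by omega
    ext x y
    simp [defect_apply]⟩
  choose g hg1 hg2 using fun (n : ℕ) (Φ : S n) => step μ Φ.1 hH2 hdef n Φ.2.1 Φ.2.2
  let s : (n : ℕ) → S n := fun n => Nat.rec base (fun n Φ => ⟨g n Φ, hg1 n Φ⟩) n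
  have hs : ∀ n, ∀ i ≤ n, (s (n + 1)).1 i = (s n).1 i := fun n => hg2 n (s n)
  have hs' : ∀ n i, i ≤ n → (s n).1 i = (s i).1 i := by
    intro n i hi
    induction n, hi using Nat.le_induction with
    | base => rfl
    | succ m hm ih => rw [hs m i hm, ih]
  refine ⟨fun n => (s n).1 n, (s 0).2.1, fun k x y => ?_⟩
  have hk : defect μ (fun n => (s n).1 n) k = 0 := by
    rw [defect_congr μ _ (s k).1 k (fun i hi => (hs' k i hi).symm)]
    exact (s k).2.2 k (by omega)
  have h := defect_apply μ (fun n => (s n).1 n) k x y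
  rw [hk, Finset.Nat.sum_antidiagonal_eq_sum_range_succ (fun a b => (s a).1 a (μ b x y)),
    Finset.Nat.sum_antidiagonal_eq_sum_range_succ
      (fun a b => μ 0 ((s a).1 a x) ((s b).1 b y))] at h
  exact sub_eq_zero.mp h.symm
end
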